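/- Let A be an m×n real matrix with rows a_1,…,a_m and b ∈ ℝ^m. If the system of inequalities a_i x ≤ b_i (i = 1,…,m) is minimally infeasible (infeasible, but feasible after deleting any single inequality), then the system of equations a_i x = b_i (i = 1,…,m) is minimally infeasible (infeasible, but feasible after deleting any single equation). -/

import Mathlib

open Matrix

/-- In a minimally infeasible system of inequalities, any set `E` of the inequalities can be
turned into equations while keeping all systems with one constraint deleted feasible. -/
theorem exists_feasible_of_minimally_infeasible {ι κ : Type*} [Fintype κ]
    (A : Matrix ι κ ℝ) (b : ι → ℝ)
    (hinf : ¬ ∃ x : κ → ℝ, ∀ i, A i ⬝ᵥ x ≤ b i)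
    (hmin : ∀ i, ∃ x : κ → ℝ, ∀ k, k ≠ i → A k ⬝ᵥ x ≤ b k) (E : Finset ι) (i : ι) :
    ∃ x : κ → ℝ, ∀ k, k ≠ i → A k ⬝ᵥ x ≤ b k ∧ (k ∈ E → A k ⬝ᵥ x = b k) := by
  classical
  induction E using Finset.induction_on generalizing i with
  | empty => simpa using hmin i
  | insert e E _ ih =>
    obtain ⟨x, hx⟩ := ih i
    by_cases hei : e = i
    · refine ⟨x, fun k hk => ⟨(hx k hk).1, fun hkE => (hx k hk).2 ?_⟩⟩
      exact Finset.mem_of_mem_insert_of_ne hkE (hei ▸ hk)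
    obtain ⟨y, hy⟩ := ih e
    have hxe : A e ⬝ᵥ x ≤ b e := (hx e hei).1
    have hye : b e < A e ⬝ᵥ y := by
      by_contra! h
      refine hinf ⟨y, fun k => ?_⟩
      by_cases hk : k = e
      · exact hk ▸ h
      · exact (hy k hk).1
    -- the point of the segment from `x` to `y` at which the constraint `e` is tight
    obtain ⟨s, t, hs, ht, hst, he⟩ : b e ∈ segment ℝ (A e ⬝ᵥ x) (A e ⬝ᵥ y) := by
      rw [segment_eq_Icc (hxe.trans hye.le)]
      exact ⟨hxe, hye.le⟩
    have hdot (k : ι) : A k ⬝ᵥ (s • x + t • y) = s * (A k ⬝ᵥ x) + t * (A k ⬝ᵥ y) := by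
      simp [dotProduct_add, dotProduct_smul]
    have hcomb (k : ι) : s * b k + t * b k = b k := by rw [← add_mul, hst, one_mul]
    refine ⟨s • x + t • y, fun k hki => ?_⟩
    rw [hdot]
    by_cases hke : k = e
    · subst hke
      exact ⟨he.le, fun _ => he⟩
    refine ⟨?_, fun hkE => ?_⟩
    · rw [← hcomb k]
      exact add_le_add (mul_le_mul_of_nonneg_left (hx k hki).1 hs)
        (mul_le_mul_of_nonneg_left (hy k hke).1 ht)
    · have hk := Finset.mem_of_mem_insert_of_ne hkE hke
      rw [(hx k hki).2 hk, (hy k hke).2 hk, hcomb]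

theorem minimally_infeasible_eq (m n : ℕ) (A : Matrix (Fin m) (Fin n) ℝ)
    (b : Fin m → ℝ)
    (hinf : ¬ ∃ x : Fin n → ℝ, ∀ i, A i ⬝ᵥ x ≤ b i)
    (hmin : ∀ i : Fin m, ∃ x : Fin n → ℝ, ∀ k, k ≠ i → A k ⬝ᵥ x ≤ b k) :
    (¬ ∃ x : Fin n → ℝ, ∀ i, A i ⬝ᵥ x = b i) ∧
    (∀ i : Fin m, ∃ x : Fin n → ℝ, ∀ k, k ≠ i → A k ⬝ᵥ x = b k) := by
  refine ⟨fun ⟨x, hx⟩ => hinf ⟨x, fun i => (hx i).le⟩, fun i => ?_⟩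
  obtain ⟨x, hx⟩ := exists_feasible_of_minimally_infeasible A b hinf hmin Finset.univ i
  exact ⟨x, fun k hk => (hx k hk).2 (Finset.mem_univ k)⟩
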